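/- arXiv:1602.06546 — 3 statements merged into one kernel-verified Lean document; each statement's English description precedes it below -/
import Mathlib

section
/- Let K be a field, V a finite-dimensional K-vector space, f : V → V a K-linear endomorphism, and σ a permutation of {1,…,n}. Then the trace of the composite P_σ ∘ f^{⊗n} : V^{⊗n} → V^{⊗n} equals the product, over all cycles c of σ (with fixed points counted as cycles of length 1), of trace(f^{length(c)}); equivalently it equals (trace f)^{n − |supp σ|} · ∏_{r ∈ cycleType(σ)} trace(f^r), where cycleType(σ) is the multiset of lengths (≥ 2) of the nontrivial cycles of σ and supp σ is its support. -/
/-- The permutation operator `P_σ` on the `n`-fold tensor power `V^{⊗n}`, sending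
`v_1 ⊗ ⋯ ⊗ v_n` to `v_{σ⁻¹(1)} ⊗ ⋯ ⊗ v_{σ⁻¹(n)}`. -/
noncomputable def permMap (K V : Type*) [CommRing K] [AddCommGroup V] [Module K V]
    {n : ℕ} (σ : Equiv.Perm (Fin n)) :
    (PiTensorProduct K fun _ : Fin n => V) →ₗ[K] PiTensorProduct K fun _ : Fin n => V :=
  (PiTensorProduct.reindex K (fun _ : Fin n => V) σ).toLinearMap

open Equiv Equiv.Perm

/-- The sum `∑ p, ∏ i, A_{p (σ i), p i}` over all colourings `p`, i.e. the trace of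
`P_σ ∘ A^{⊗α}` computed in the product basis. -/
def permTrace {α κ R : Type*} [Fintype α] [DecidableEq α] [Fintype κ] [CommRing R]
    (A : Matrix κ κ R) (σ : Perm α) : R :=
  ∑ p : α → κ, ∏ i, A (p (σ i)) (p i)

section

variable {α β κ R : Type*} [Fintype α] [DecidableEq α] [Fintype β] [DecidableEq β]
  [Fintype κ] [CommRing R]

theorem permTrace_congr (A : Matrix κ κ R) (e : α ≃ β) {σ : Perm α} {τ : Perm β}
    (h : ∀ i, e (σ i) = τ (e i)) : permTrace A σ = permTrace A τ := by
  unfold permTrace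
  rw [← (e.arrowCongr (Equiv.refl κ)).symm.sum_comp]
  refine Finset.sum_congr rfl fun p _ => ?_
  rw [← e.prod_comp]
  simp [h]

theorem permTrace_eq_mul_subtype (A : Matrix κ κ R) (σ : Perm α) (p : α → Prop) [DecidablePred p]
    (h : ∀ x, p (σ x) ↔ p x) :
    permTrace A σ = permTrace A (σ.subtypePerm h) *
      permTrace A (σ.subtypePerm (p := fun x => ¬ p x) fun x => not_congr (h x)) := by
  unfold permTrace
  rw [Fintype.sum_mul_sum, ← Fintype.sum_prod_type',
    ← (Equiv.piEquivPiSubtypeProd p fun _ => κ).sum_comp]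
  refine Finset.sum_congr rfl fun q _ => ?_
  rw [← Fintype.prod_subtype_mul_prod_subtype p]
  rfl

theorem permTrace_one (A : Matrix κ κ R) :
    permTrace A (1 : Perm α) = A.trace ^ Fintype.card α := by
  rw [← Finset.card_univ, ← Finset.prod_const, Matrix.trace, Finset.prod_univ_sum,
    Fintype.piFinset_univ]
  rfl

theorem cycleType_permCongr (e : α ≃ β) (σ : Perm α) :
    (e.permCongr σ).cycleType = σ.cycleType := by
  let g : α ≃ {_x : β // True} := e.trans (Equiv.subtypeUnivEquiv fun _ => trivial).symm
  rw [← cycleType_extendDomain g]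
  congr 1

theorem cycleType_eq_add_subtypePerm (σ : Perm α) (p : α → Prop) [DecidablePred p]
    (h : ∀ x, p (σ x) ↔ p x) :
    σ.cycleType = (σ.subtypePerm h).cycleType +
      (σ.subtypePerm (p := fun x => ¬ p x) fun x => not_congr (h x)).cycleType := by
  have hd : Perm.Disjoint (ofSubtype (σ.subtypePerm h))
      (ofSubtype (σ.subtypePerm (p := fun x => ¬ p x) fun x => not_congr (h x))) := by
    intro x
    by_cases hx : p x
    · exact Or.inr (ofSubtype_apply_of_not_mem _ (not_not.2 hx))
    · exact Or.inl (ofSubtype_apply_of_not_mem _ hx)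
  rw [← cycleType_ofSubtype, ← cycleType_ofSubtype (p := fun x => ¬ p x), ← hd.cycleType_mul]
  congr 1
  ext x
  by_cases hx : p x
  · rw [Perm.mul_apply, ofSubtype_apply_of_not_mem (p := fun x => ¬ p x) _ (not_not.2 hx),
      ofSubtype_subtypePerm_of_mem h hx]
  · rw [Perm.mul_apply, ofSubtype_subtypePerm_of_mem (p := fun x => ¬ p x) _ hx,
      ofSubtype_apply_of_not_mem _ (by rwa [h])]

end

section

variable {α κ R : Type*} [Fintype α] [DecidableEq α] [Fintype κ] [DecidableEq κ] [CommRing R]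

/-- Entries of matrix powers as sums over paths. -/
theorem pow_succ_apply_eq_sum_prod (A : Matrix κ κ R) (k : ℕ) (i j : κ) :
    (A ^ (k + 1)) i j = ∑ q : Fin k → κ, ∏ t : Fin (k + 1),
      A (Fin.snoc (α := fun _ => κ) q i t) (Fin.cons (α := fun _ => κ) j q t) := by
  induction k generalizing j with
  | zero => simp [Fin.snoc]
  | succ k ih =>
    rw [pow_succ, Matrix.mul_apply, ← (Fin.consEquiv fun _ : Fin (k + 1) => κ).sum_comp,
      Fintype.sum_prod_type]
    refine Finset.sum_congr rfl fun m _ => ?_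
    rw [ih, Finset.sum_mul]
    refine Finset.sum_congr rfl fun q _ => ?_
    rw [Fin.prod_univ_succ (n := k + 1), mul_comm]
    simp [Fin.consEquiv, ← Fin.cons_snoc_eq_snoc_cons]

theorem permTrace_finRotate (A : Matrix κ κ R) (k : ℕ) :
    permTrace A (finRotate (k + 1)) = (A ^ (k + 1)).trace := by
  unfold permTrace Matrix.trace
  rw [← (Fin.consEquiv fun _ : Fin (k + 1) => κ).sum_comp, Fintype.sum_prod_type]
  refine Finset.sum_congr rfl fun i _ => ?_
  rw [Matrix.diag_apply, pow_succ_apply_eq_sum_prod]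
  simp only [Fin.snoc_eq_cons_rotate]
  rfl

theorem permTrace_of_cycleType_eq_card (A : Matrix κ κ R) (σ : Perm α)
    (h : σ.cycleType = {Fintype.card α}) : permTrace A σ = (A ^ Fintype.card α).trace := by
  have h2 : 2 ≤ Fintype.card α := two_le_of_mem_cycleType (σ := σ) (by simp [h])
  let e := Fintype.equivFin α
  obtain ⟨c, hc⟩ := isConj_iff.1 (isConj_of_cycleType_eq (σ := e.permCongr σ)
    (τ := finRotate (Fintype.card α)) (by
      rw [cycleType_finRotate_of_le h2, cycleType_permCongr, h]))
  rw [permTrace_congr A (e.trans c) (τ := finRotate (Fintype.card α))]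
  · obtain ⟨k, hk⟩ : ∃ k, Fintype.card α = k + 1 := ⟨_, (Nat.sub_add_cancel (by omega)).symm⟩
    rw [hk, permTrace_finRotate]
  · intro i
    simp [← hc]

theorem permTrace_eq (A : Matrix κ κ R) (σ : Perm α) :
    permTrace A σ = A.trace ^ (Fintype.card α - σ.cycleType.sum) *
      (σ.cycleType.map fun r => (A ^ r).trace).prod := by
  induction hn : Fintype.card α using Nat.strong_induction_on generalizing α with
  | _ n ih =>
  subst hn
  by_cases hσ : σ = 1
  · simp [hσ, permTrace_one]
  obtain ⟨a, ha⟩ : ∃ a, σ a ≠ a := by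
    contrapose! hσ
    exact Perm.ext hσ
  obtain ⟨p, hp⟩ : ∃ p : α → Prop, ∀ x, p x ↔ σ.SameCycle a x := ⟨_, fun _ => Iff.rfl⟩
  classical
  have h : ∀ x, p (σ x) ↔ p x := fun x => by rw [hp, hp, sameCycle_apply_right]
  have hc : (σ.subtypePerm h).cycleType = {Fintype.card {x // p x}} := by
    rw [← cycleType_ofSubtype, Fintype.card_of_subtype (σ.cycleOf a).support fun x => by
      rw [hp, mem_support_cycleOf_iff' ha], ← (isCycle_cycleOf σ ha).cycleType]
    congr 1
    ext x
    by_cases hx : p x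
    · rw [ofSubtype_subtypePerm_of_mem h hx, ((hp x).1 hx).cycleOf_apply]
    · rw [ofSubtype_apply_of_not_mem _ hx, cycleOf_apply_of_not_sameCycle (mt (hp x).2 hx)]
  have hcard := Fintype.card_subtype_compl p
  have hle := Fintype.card_subtype_le p
  have hpos : 0 < Fintype.card {x // p x} :=
    Fintype.card_pos_iff.2 ⟨⟨a, (hp a).2 (SameCycle.refl _ _)⟩⟩
  rw [permTrace_eq_mul_subtype A σ p h, cycleType_eq_add_subtypePerm σ p h,
    permTrace_of_cycleType_eq_card A _ hc, ih _ (by omega) _ rfl, hc, hcard]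
  simp only [Multiset.sum_add, Multiset.sum_singleton, Multiset.map_add, Multiset.prod_add,
    Multiset.map_singleton, Multiset.prod_singleton, Nat.sub_add_eq]
  ring

end

theorem trace_permMap_comp_map_eq_permTrace {K V κ : Type*} [CommRing K] [AddCommGroup V]
    [Module K V] [Fintype κ] [DecidableEq κ] (b : Module.Basis κ K V) (f : V →ₗ[K] V) {n : ℕ}
    (σ : Perm (Fin n)) :
    LinearMap.trace K _ (permMap K V σ ∘ₗ PiTensorProduct.map fun _ : Fin n => f) =
      permTrace (LinearMap.toMatrix b b f) σ := by
  rw [LinearMap.trace_eq_matrix_trace K (Basis.piTensorProduct fun _ : Fin n => b)]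
  refine Finset.sum_congr rfl fun p _ => ?_
  rw [Matrix.diag_apply, LinearMap.toMatrix_apply, ← σ.symm.prod_comp]
  simp [permMap, LinearMap.toMatrix_apply]

theorem stmt1 (K V : Type*) [Field K] [AddCommGroup V] [Module K V] [FiniteDimensional K V]
    (f : V →ₗ[K] V) (n : ℕ) (σ : Equiv.Perm (Fin n)) :
    LinearMap.trace K _ (permMap K V σ ∘ₗ PiTensorProduct.map fun _ : Fin n => f) =
      LinearMap.trace K V f ^ (n - σ.support.card) *
        (σ.cycleType.map fun r => LinearMap.trace K V (f ^ r)).prod := by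
  have b := Module.finBasis K V
  rw [trace_permMap_comp_map_eq_permTrace b, permTrace_eq, sum_cycleType, Fintype.card_fin]
  simp only [LinearMap.trace_eq_matrix_trace K b, LinearMap.toMatrix_pow]
end

section
/- Let K be a field, V a finite-dimensional K-vector space, f : V → V a K-linear endomorphism, and let σ be a single n-cycle in the symmetric group on {1,…,n} (n ≥ 1). Then trace(P_σ ∘ f^{⊗n} : V^{⊗n} → V^{⊗n}) = trace(f^n). (This is the Atiyah-type trace formula underlying the definition of the Adams operation ψ_n and equation (trl) of the paper: the trace of the n-th Adams operation applied to (V,f) is trace(f^n).) -/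
namespace Matrix

variable {κ R : Type*} [Fintype κ] [DecidableEq κ] [CommSemiring R]

/-- The entries of a power of a matrix as sums over paths. -/
theorem pow_succ_apply_eq_sum_prod (A : Matrix κ κ R) (m : ℕ) (a c : κ) :
    (A ^ (m + 1)) a c = ∑ q : Fin m → κ, ∏ k : Fin (m + 1),
      A ((Fin.cons a q : Fin (m + 1) → κ) k) ((Fin.snoc q c : Fin (m + 1) → κ) k) := by
  induction m generalizing a with
  | zero => simp [Fin.snoc]
  | succ m ih =>
    rw [pow_succ', mul_apply, ← (Fin.consEquiv fun _ : Fin (m + 1) => κ).sum_comp,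
      Fintype.sum_prod_type]
    refine Finset.sum_congr rfl fun x _ => ?_
    rw [ih, Finset.mul_sum]
    refine Finset.sum_congr rfl fun q _ => ?_
    rw [Fin.prod_univ_succ (n := m + 1)]
    simp [Fin.consEquiv, ← Fin.cons_snoc_eq_snoc_cons]

/-- The trace of a power of a matrix as a sum over closed paths. -/
theorem trace_pow_succ_eq_sum_prod (A : Matrix κ κ R) (m : ℕ) :
    (A ^ (m + 1)).trace =
      ∑ q : Fin (m + 1) → κ, ∏ k, A (q k) (q (finRotate (m + 1) k)) := by
  rw [← (Fin.consEquiv fun _ : Fin (m + 1) => κ).sum_comp, Fintype.sum_prod_type, trace]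
  refine Finset.sum_congr rfl fun a _ => ?_
  rw [diag_apply, pow_succ_apply_eq_sum_prod]
  simp only [Fin.snoc_eq_cons_rotate]
  rfl

end Matrix

/-- A cyclic permutation of all of `Fin (m + 1)` is conjugate to `finRotate`. -/
theorem Equiv.Perm.IsCycleOn.exists_equiv_apply_finRotate {m : ℕ} {τ : Equiv.Perm (Fin (m + 1))}
    (hτ : τ.IsCycleOn (_root_.Set.univ : Set (Fin (m + 1)))) :
    ∃ e : Fin (m + 1) ≃ Fin (m + 1), ∀ k, e (finRotate (m + 1) k) = τ (e k) := by
  rw [← Finset.coe_univ] at hτ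
  let g : Fin (m + 1) → Fin (m + 1) := fun k => (τ ^ (k : ℕ)) 0
  have hg : Function.Surjective g := fun b => by
    obtain ⟨j, hj, hjb⟩ := hτ.exists_pow_eq (Finset.mem_univ 0) (Finset.mem_univ b)
    exact ⟨⟨j, by simpa using hj⟩, hjb⟩
  refine ⟨Equiv.ofBijective g (Finite.surjective_iff_bijective.mp hg), fun k => ?_⟩
  change (τ ^ (finRotate (m + 1) k : ℕ)) 0 = τ ((τ ^ (k : ℕ)) 0)
  rw [← Equiv.Perm.mul_apply, ← pow_succ', coe_finRotate]
  split_ifs with h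
  · have := hτ.pow_card_apply (Finset.mem_univ 0)
    rw [Finset.card_fin] at this
    simp [h, this]
  · rfl

/-- The trace of `f^{⊗ι}` followed by a permutation of the factors, in terms of a matrix of `f`. -/
theorem PiTensorProduct.trace_reindex_comp_map {ι κ R M : Type*} [Fintype ι] [DecidableEq ι] [Fintype κ]
    [DecidableEq κ] [CommRing R] [AddCommGroup M] [Module R M] (b : Module.Basis κ R M)
    (f : M →ₗ[R] M) (σ : Equiv.Perm ι) :
    LinearMap.trace R _ ((PiTensorProduct.reindex R (fun _ : ι => M) σ).toLinearMap ∘ₗ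
        PiTensorProduct.map fun _ : ι => f) =
      ∑ p : ι → κ, ∏ i, LinearMap.toMatrix b b f (p i) (p (σ.symm i)) := by
  rw [LinearMap.trace_eq_matrix_trace R (Basis.piTensorProduct fun _ : ι => b), Matrix.trace]
  refine Finset.sum_congr rfl fun p _ => ?_
  rw [Matrix.diag_apply, LinearMap.toMatrix_apply, Basis.piTensorProduct_apply,
    LinearMap.comp_apply, PiTensorProduct.map_tprod]
  erw [PiTensorProduct.reindex_tprod, Basis.piTensorProduct_repr_tprod_apply]
  simp only [LinearMap.toMatrix_apply]

/-- Atiyah-type trace formula: for `σ` a single `n`-cycle (i.e. `σ` acts as one cycle on all of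
`{1,…,n}`), the trace of `P_σ ∘ f^{⊗n}` equals `trace (f^n)`. -/
theorem stmt2 (K V : Type*) [Field K] [AddCommGroup V] [Module K V] [FiniteDimensional K V]
    (f : V →ₗ[K] V) (n : ℕ) (hn : 1 ≤ n) (σ : Equiv.Perm (Fin n))
    (hσ : σ.IsCycleOn (Set.univ : Set (Fin n))) :
    LinearMap.trace K _ (permMap K V σ ∘ₗ PiTensorProduct.map fun _ : Fin n => f) =
      LinearMap.trace K V (f ^ n) := by
  obtain ⟨m, rfl⟩ := Nat.exists_eq_add_of_le' hn
  let b := Module.finBasis K V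
  obtain ⟨e, he⟩ := hσ.inv.exists_equiv_apply_finRotate
  rw [permMap, PiTensorProduct.trace_reindex_comp_map b, LinearMap.trace_eq_matrix_trace K b,
    ← LinearMap.toMatrix_pow, Matrix.trace_pow_succ_eq_sum_prod]
  refine Fintype.sum_equiv (e.symm.arrowCongr (Equiv.refl _)) _ _ fun p => ?_
  rw [← e.prod_comp]
  refine Finset.prod_congr rfl fun k _ => ?_
  exact congrArg (fun i => LinearMap.toMatrix b b f (p (e k)) (p i)) (he k).symm
end

section
/- Let σ be a finite type (a finite set of variables). For every n ≥ 0, the n-th complete homogeneous symmetric polynomial satisfies, in MvPolynomial σ ℚ: h_n = ∑_{λ ⊢ n} (1/z_λ) · ∏_{r ∈ parts(λ)} p_r, the sum being over all partitions λ of n, where the product is over the parts of λ with multiplicity and p_r is the r-th power sum. (This is the paper's formula cl_n(V) = ∑_{λ⊢n} (χ_λ(V)/z_λ) p_λ, Example 2.x, specialized to the trivial representation, whose character is identically 1.) -/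
def zpart {n : ℕ} (p : n.Partition) : ℕ :=
  ∏ r ∈ p.parts.toFinset, r ^ p.parts.count r * (p.parts.count r).factorial

namespace MvPolynomial

variable {σ R : Type*} [Fintype σ] [DecidableEq σ] [CommSemiring R]

theorem sum_prod_X_filter_le_count (i : σ) {k n : ℕ} (hk : k ≤ n) :
    ∑ s : Sym σ n with k ≤ s.1.count i, (s.1.map (X (R := R))).prod =
      X i ^ k * hsymm σ R (n - k) := by
  rw [hsymm, Finset.mul_sum]
  symm
  refine Finset.sum_bij
    (fun t _ ↦ ⟨Multiset.replicate k i + t.1, by simp [hk]⟩) ?_ ?_ ?_ ?_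
  · intro t _
    refine Finset.mem_filter.mpr ⟨Finset.mem_univ _, ?_⟩
    change k ≤ (Multiset.replicate k i + t.1).count i
    simp
  · intro t _ t' _ h
    exact Subtype.ext (add_left_cancel (congrArg Subtype.val h))
  · intro s hs
    have hs' : Multiset.replicate k i ≤ s.1 :=
      Multiset.le_count_iff_replicate_le.mp (Finset.mem_filter.mp hs).2
    refine ⟨⟨s.1 - Multiset.replicate k i, ?_⟩, Finset.mem_univ _, ?_⟩
    · rw [Multiset.card_sub hs', s.2, Multiset.card_replicate]
    · exact Subtype.ext (add_tsub_cancel_of_le hs')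
  · intro t _
    simp

theorem natCast_mul_hsymm (n : ℕ) :
    (n : MvPolynomial σ R) * hsymm σ R n =
      ∑ k ∈ Finset.Icc 1 n, psum σ R k * hsymm σ R (n - k) := by
  have key (s : Sym σ n) : n = ∑ k ∈ Finset.Icc 1 n, ∑ i : σ, if k ≤ s.1.count i then 1 else 0 := by
    have hcard : ∑ i : σ, s.1.count i = n :=
      (Multiset.sum_count_eq_card fun a _ ↦ Finset.mem_univ a).trans s.2
    rw [Finset.sum_comm]
    conv_lhs => rw [← hcard]
    refine Finset.sum_congr rfl fun i _ ↦ ?_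
    have hle : s.1.count i ≤ n := (Multiset.count_le_card i s.1).trans_eq s.2
    have : (Finset.Icc 1 n).filter (· ≤ s.1.count i) = Finset.Icc 1 (s.1.count i) := by
      ext k
      simp only [Finset.mem_filter, Finset.mem_Icc]
      omega
    rw [← Finset.card_filter, this, Nat.card_Icc, Nat.add_sub_cancel]
  calc (n : MvPolynomial σ R) * hsymm σ R n
      = ∑ s : Sym σ n, ∑ k ∈ Finset.Icc 1 n, ∑ i : σ,
          if k ≤ s.1.count i then (s.1.map (X (R := R))).prod else 0 := by
        rw [hsymm, Finset.mul_sum]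
        refine Finset.sum_congr rfl fun s _ ↦ ?_
        refine (congrArg (fun m : ℕ ↦ (m : MvPolynomial σ R) * (s.1.map X).prod) (key s)).trans ?_
        simp only [Nat.cast_sum, Nat.cast_ite, Nat.cast_one, Nat.cast_zero, Finset.sum_mul, ite_mul,
          one_mul, zero_mul]
    _ = ∑ k ∈ Finset.Icc 1 n, ∑ i : σ, ∑ s : Sym σ n with k ≤ s.1.count i,
          (s.1.map (X (R := R))).prod := by
        rw [Finset.sum_comm]
        refine Finset.sum_congr rfl fun k _ ↦ ?_
        rw [Finset.sum_comm]
        simp_rw [Finset.sum_filter]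
    _ = _ := by
        refine Finset.sum_congr rfl fun k hk ↦ ?_
        rw [psum, Finset.sum_mul]
        exact Finset.sum_congr rfl fun i _ ↦
          sum_prod_X_filter_le_count i (Finset.mem_Icc.mp hk).2

end MvPolynomial

theorem zpart_eq_prod {n : ℕ} (p : n.Partition) {s : Finset ℕ} (hs : p.parts.toFinset ⊆ s) :
    zpart p = ∏ r ∈ s, r ^ p.parts.count r * (p.parts.count r).factorial := by
  refine Finset.prod_subset hs fun r _ hr ↦ ?_
  simp [Multiset.count_eq_zero.mpr (mt Multiset.mem_toFinset.mpr hr)]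

theorem zpart_of_parts_eq_cons {n m a : ℕ} {p : n.Partition} {q : m.Partition}
    (h : p.parts = a ::ₘ q.parts) : zpart p = a * p.parts.count a * zpart q := by
  have hq : q.parts.toFinset ⊆ p.parts.toFinset := by
    simp [h]
  have ha : a ∈ p.parts.toFinset := by simp [h]
  rw [zpart_eq_prod q hq, zpart, ← Finset.mul_prod_erase _ _ ha, ← Finset.mul_prod_erase _ _ ha,
    ← mul_assoc]
  congr 1
  · rw [h, Multiset.count_cons_self, Nat.factorial_succ]
    ring
  · refine Finset.prod_congr rfl fun r hr ↦ ?_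
    rw [h, Multiset.count_cons_of_ne (Finset.ne_of_mem_erase hr)]

/-- The recursion `n aₙ = ∑ₖ f k aₙ₋ₖ` for the weighted sums `aₙ = ∑_{λ ⊢ n} z_λ⁻¹ ∏_{r ∈ λ} f r`. -/
theorem natCast_mul_sum_inv_zpart_smul {A : Type*} [CommRing A] [Algebra ℚ A] (f : ℕ → A) (n : ℕ) :
    (n : A) * ∑ p : n.Partition, (zpart p : ℚ)⁻¹ • (p.parts.map f).prod =
      ∑ k ∈ Finset.Icc 1 n,
        f k * ∑ p : (n - k).Partition, (zpart p : ℚ)⁻¹ • (p.parts.map f).prod := by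
  have key (p : n.Partition) : (n : A) * ((zpart p : ℚ)⁻¹ • (p.parts.map f).prod) =
      ∑ k ∈ Finset.Icc 1 n,
        ((k * p.parts.count k : ℕ) * (zpart p : ℚ)⁻¹ : ℚ) • (p.parts.map f).prod := by
    have hn : n = ∑ k ∈ Finset.Icc 1 n, k * p.parts.count k := by
      conv_lhs => rw [← p.parts_sum]
      rw [Finset.sum_multiset_count_of_subset p.parts (Finset.Icc 1 n) (by grind)]
      simp [mul_comm]
    rw [← Finset.sum_smul, ← Finset.sum_mul, ← Nat.cast_sum, ← hn, mul_smul, Nat.cast_smul_eq_nsmul,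
      nsmul_eq_mul]
  rw [Finset.mul_sum, Finset.sum_congr rfl fun p _ ↦ key p, Finset.sum_comm]
  refine Finset.sum_congr rfl fun k hk ↦ ?_
  obtain ⟨hk1, hkn⟩ := Finset.mem_Icc.mp hk
  let e := Nat.Partition.partitionWithPartEquiv hk1 hkn
  have hvanish (p : n.Partition) (hp : k ∉ p.parts) :
      ((k * p.parts.count k : ℕ) * (zpart p : ℚ)⁻¹ : ℚ) • (p.parts.map f).prod = 0 := by
    simp [Multiset.count_eq_zero.mpr hp]
  rw [Finset.mul_sum, ← Finset.sum_filter_of_ne (p := fun p ↦ k ∈ p.parts)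
      fun p _ ↦ not_imp_comm.mp (hvanish p),
    Finset.sum_subtype _ (p := fun p ↦ k ∈ p.parts) (by simp), ← e.symm.sum_comp]
  refine Finset.sum_congr rfl fun q _ ↦ ?_
  have hparts : (e.symm q).1.parts = k ::ₘ q.parts :=
    Nat.Partition.partitionWithPartEquiv_symm_apply_parts hk1 hkn q
  have hcount : (k * (e.symm q).1.parts.count k : ℕ) ≠ 0 := by
    rw [hparts, Multiset.count_cons_self]
    positivity
  rw [zpart_of_parts_eq_cons hparts, Nat.cast_mul (_ * _), mul_inv,
    mul_inv_cancel_left₀ (Nat.cast_ne_zero.mpr hcount), hparts, Multiset.map_cons,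
    Multiset.prod_cons, mul_smul_comm]

/-- `h_n = ∑_{λ ⊢ n} (1/z_λ) ∏_{r ∈ parts(λ)} p_r` in `MvPolynomial σ ℚ`. -/
theorem stmt14 (σ : Type*) [Fintype σ] [DecidableEq σ] (n : ℕ) :
    MvPolynomial.hsymm σ ℚ n =
      ∑ p : n.Partition, (zpart p : ℚ)⁻¹ • (p.parts.map (MvPolynomial.psum σ ℚ)).prod := by
  induction n using Nat.strong_induction_on with
  | _ n ih =>
    rcases Nat.eq_zero_or_pos n with rfl | hn
    · simp [zpart]
    · refine mul_left_cancel₀ (Nat.cast_ne_zero.mpr hn.ne' : (n : MvPolynomial σ ℚ) ≠ 0) ?_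
      rw [MvPolynomial.natCast_mul_hsymm, natCast_mul_sum_inv_zpart_smul]
      refine Finset.sum_congr rfl fun k hk ↦ ?_
      rw [ih (n - k) (by grind)]
end
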